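/- For the random-walk dynamical system, assume (i) Σ_{β∈ℤ^d} |β|^ν p_β<∞ where ν:=max{2,⌊d/2⌋+1}, and (ii) the subgroup of ℤ^d generated by {β^{(j)}−β^{(j')} : j∈Z_N} (for some, equivalently any, j'∈Z_N) is all of ℤ^d. Then for every m∈ℕ the system is (M5)-mixing relative to 𝔊_m and 𝔏_m, i.e., for every F∈𝔊_m: lim_{n→∞} sup{ |∫(F∘T^n)g dμ − Avg(F)∫g dμ| / ∫|g|dμ : g∈𝔏_m, g≠0 } = 0. -/

import Mathlib

noncomputable section

open MeasureTheory Filter Topology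

/-- The phase space `X = ℤ^d × [0,1)²` (embedded in `ℤ^d × ℝ²`; the invariant measure
is supported on `ℤ^d × [0,1)²`). -/
abbrev RWSpace (d : ℕ) := (Fin d → ℤ) × ℝ × ℝ

/-- The data of a random walk on `ℤ^d`: a probability distribution `p` on `ℤ^d` together
with an enumeration `e` of `ℤ^d` (whose restriction to the support of `p` enumerates the
set `D` of active directions; indices carrying zero probability contribute empty
rectangles and do not affect the map). -/
structure RW (d : ℕ) where
  p : (Fin d → ℤ) → ℝ
  nonneg : ∀ β, 0 ≤ p β
  total : HasSum p 1
  e : ℕ ≃ (Fin d → ℤ)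

namespace RW

variable {d : ℕ}

/-- The cumulative sums `q_k = Σ_{j<k} p_{β^{(j)}}`. -/
def q (R : RW d) (k : ℕ) : ℝ := ∑ j ∈ Finset.range k, R.p (R.e j)

/-- The index `k` such that `y ∈ [q_k, q_{k+1})` (for `y ∈ [0,1)`). -/
def idx (R : RW d) (y : ℝ) : ℕ := sSup {j | R.q j ≤ y}

/-- The random-walk (coupled bakers') map
`T(α; y₁, y₂) = (α + β^{(k)}; p_{β^{(k)}}⁻¹(y₁ − q_{k-1}), p_{β^{(k)}} y₂ + q_{k-1})`. -/
def T (R : RW d) : RWSpace d → RWSpace d := fun x =>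
  (x.1 + R.e (R.idx x.2.1),
   (x.2.1 - R.q (R.idx x.2.1)) / R.p (R.e (R.idx x.2.1)),
   R.p (R.e (R.idx x.2.1)) * x.2.2 + R.q (R.idx x.2.1))

/-- The inverse of the random-walk map. -/
def Tinv (R : RW d) : RWSpace d → RWSpace d := fun x =>
  (x.1 - R.e (R.idx x.2.2),
   R.p (R.e (R.idx x.2.2)) * x.2.1 + R.q (R.idx x.2.2),
   (x.2.2 - R.q (R.idx x.2.2)) / R.p (R.e (R.idx x.2.2)))

/-- The iterate `T^t` for `t ∈ ℤ` (using the inverse map for negative times). -/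
def iterZ (R : RW d) (t : ℤ) : RWSpace d → RWSpace d :=
  if 0 ≤ t then (R.T)^[t.toNat] else (R.Tinv)^[(-t).toNat]

end RW

/-- The invariant measure `μ`: counting measure on `ℤ^d` times Lebesgue measure on
`[0,1)²`. -/
def rwMeasure (d : ℕ) : Measure (RWSpace d) :=
  (Measure.count : Measure (Fin d → ℤ)).prod
    ((volume.restrict (Set.Ico (0:ℝ) 1)).prod (volume.restrict (Set.Ico (0:ℝ) 1)))

/-- The set `V = B_{γ,r} × [0,1)²`, where `B_{γ,r}` is the square box of center `γ` and
radius `r` in `ℤ^d`. -/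
def rwBox {d : ℕ} (γ : Fin d → ℤ) (r : ℕ) : Set (RWSpace d) :=
  {x | (∀ i, |x.1 i - γ i| ≤ (r : ℤ)) ∧ x.2.1 ∈ Set.Ico (0:ℝ) 1 ∧ x.2.2 ∈ Set.Ico (0:ℝ) 1}

/-- The exhaustive family `𝒱 = {B_{γ,r} × [0,1)² : γ ∈ ℤ^d, r ∈ ℤ⁺}`. -/
def rwFamily (d : ℕ) : Set (Set (RWSpace d)) :=
  {V | ∃ γ : Fin d → ℤ, ∃ r : ℕ, 1 ≤ r ∧ V = rwBox γ r}

/-- The (μ-uniform) infinite-volume limit of a set function `φ` along the family `𝒱`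
equals `L`. -/
def IVLim {Y : Type*} [MeasurableSpace Y] (μ : Measure Y) (𝒱 : Set (Set Y))
    (φ : Set Y → ℝ) (L : ℝ) : Prop :=
  ∀ ε > 0, ∃ M : ℝ, 0 < M ∧ ∀ V ∈ 𝒱, M ≤ (μ V).toReal → |φ V - L| < ε

/-- The normalized average `μ_V(F) = (1/μ(V)) ∫_V F dμ` of `F` over a set `V`. -/
def avgOn {Y : Type*} [MeasurableSpace Y] (μ : Measure Y) (F : Y → ℝ) (V : Set Y) : ℝ :=
  (∫ x in V, F x ∂μ) / (μ V).toReal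

/-- `F` possesses the infinite-volume average `L` along the family `𝒱`. -/
def HasAvg {Y : Type*} [MeasurableSpace Y] (μ : Measure Y) (𝒱 : Set (Set Y))
    (F : Y → ℝ) (L : ℝ) : Prop :=
  IVLim μ 𝒱 (avgOn μ F) L

/-- The σ-algebra `ℬ` generated by the partition `{S_α}` of the phase space into unit
squares `S_α = {α} × [0,1)²`. -/
def rwB0 (d : ℕ) : MeasurableSpace (RWSpace d) :=
  MeasurableSpace.generateFrom
    {S | ∃ α : Fin d → ℤ, S = {α} ×ˢ (Set.Ico (0:ℝ) 1 ×ˢ Set.Ico (0:ℝ) 1)}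

/-- The σ-algebra `T^k ℬ = {T^{-k} A : A ∈ ℬ}` for `k ∈ ℤ`. -/
def rwBk {d : ℕ} (R : RW d) (k : ℤ) : MeasurableSpace (RWSpace d) :=
  MeasurableSpace.comap (RW.iterZ R k) (rwB0 d)

/-- The σ-algebra `ℬ_{ℓ,m} = T^ℓ ℬ ∨ ⋯ ∨ T^m ℬ`. -/
def rwBlm {d : ℕ} (R : RW d) (l m : ℤ) : MeasurableSpace (RWSpace d) :=
  ⨆ k ∈ Finset.Icc l m, rwBk R k

/-- `L^∞(X, ℬ_{−m,m}, μ)`: bounded observables measurable w.r.t. `ℬ_{−m,m}`. -/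
def rwLinftyB {d : ℕ} (R : RW d) (m : ℕ) : Set (RWSpace d → ℝ) :=
  {F | Measurable[rwBlm R (-(m : ℤ)) (m : ℤ)] F ∧ ∃ C, ∀ x, |F x| ≤ C}

/-- The class of global observables `𝔊_m`. -/
def rwG {d : ℕ} (R : RW d) (m : ℕ) : Set (RWSpace d → ℝ) :=
  {F | F ∈ rwLinftyB R m ∧ ∃ A : ℝ, HasAvg (rwMeasure d) (rwFamily d) F A}

section NormedAlgebra

variable {B : Type*} [NormedRing B]

/-- The homogeneous geometric sum `∑_{i<k} S^i S'^(k-1-i)`. -/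
def geomTwo (S S' : B) : ℕ → B
  | 0 => 0
  | k + 1 => S * geomTwo S S' k + S' ^ k

lemma geomTwo_mul_sub {S S' : B} (h : Commute S S') (k : ℕ) :
    geomTwo S S' k * (S - S') = S ^ k - S' ^ k := by
  induction k with
  | zero => simp [geomTwo]
  | succ k ih =>
    have := (h.pow_right k).eq
    rw [geomTwo, add_mul, mul_assoc, ih, mul_sub, mul_sub, ← this, pow_succ', pow_succ S' k]
    abel

lemma commute_geomTwo {P S S' : B} (h : Commute P S) (h' : Commute P S') (k : ℕ) :
    Commute P (geomTwo S S' k) := by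
  induction k with
  | zero => exact Commute.zero_right _
  | succ k ih => exact (h.mul_right ih).add_right (h'.pow_right k)

lemma norm_pow_le_one' (h1 : ‖(1 : B)‖ ≤ 1) {P : B} (hP : ‖P‖ ≤ 1) (k : ℕ) : ‖P ^ k‖ ≤ 1 := by
  induction k with
  | zero => simpa using h1
  | succ k ih =>
    rw [pow_succ]
    exact (norm_mul_le _ _).trans (mul_le_one₀ ih (norm_nonneg _) hP)

lemma norm_geomTwo_le (h1 : ‖(1 : B)‖ ≤ 1) {S S' : B} (hS : ‖S‖ ≤ 1) (hS' : ‖S'‖ ≤ 1) (k : ℕ) :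
    ‖geomTwo S S' k‖ ≤ k := by
  induction k with
  | zero => simp [geomTwo]
  | succ k ih =>
    calc ‖S * geomTwo S S' k + S' ^ k‖ ≤ ‖S‖ * ‖geomTwo S S' k‖ + ‖S' ^ k‖ :=
          (norm_add_le _ _).trans (by gcongr; exact norm_mul_le _ _)
      _ ≤ 1 * k + 1 := by gcongr; exact norm_pow_le_one' h1 hS' k
      _ = ((k + 1 : ℕ) : ℝ) := by push_cast; ring

variable [NormedAlgebra ℝ B]

lemma norm_pow_sub_geomTwo_le (h1 : ‖(1 : B)‖ ≤ 1) {P S S' : B} {c : ℝ} (hc : 0 ≤ c)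
    (hP : ‖P‖ ≤ 1) (hS : ‖S‖ ≤ 1) (hS' : ‖S'‖ ≤ 1) (hPS : ‖P - c • S‖ ≤ 1 - c)
    (hPSS : ‖P - c • S - c • S'‖ ≤ 1 - 2 * c) (k : ℕ) :
    ‖P ^ k - c ^ k • geomTwo S S' (k + 1)‖ ≤ 1 - (k + 1) * c ^ k := by
  induction k with
  | zero => simp [geomTwo]
  | succ k ih =>
    have key : P ^ (k + 1) - c ^ (k + 1) • geomTwo S S' (k + 1 + 1)
        = P * (P ^ k - c ^ k • geomTwo S S' (k + 1))
          + c ^ k • ((P - c • S) * (S * geomTwo S S' k) + (P - c • S - c • S') * S' ^ k) := by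
      simp only [geomTwo, pow_succ' P, pow_succ' S', pow_succ' c, mul_sub, sub_mul, mul_add, smul_add,
        smul_sub, mul_smul_comm, smul_mul_assoc, mul_smul, smul_comm c (c ^ k)]
      abel
    have hG := norm_geomTwo_le h1 hS hS' k
    have hSp := norm_pow_le_one' h1 hS' k
    have hck : 0 ≤ c ^ k := by positivity
    have hc1 : 0 ≤ 1 - c := (norm_nonneg _).trans hPS
    have hc2 : 0 ≤ 1 - 2 * c := (norm_nonneg _).trans hPSS
    have t1 : ‖P * (P ^ k - c ^ k • geomTwo S S' (k + 1))‖ ≤ 1 * (1 - (k + 1) * c ^ k) :=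
      (norm_mul_le _ _).trans (by gcongr)
    have t2 : ‖(P - c • S) * (S * geomTwo S S' k)‖ ≤ (1 - c) * (1 * k) := by
      refine (norm_mul_le _ _).trans ?_
      gcongr
      refine (norm_mul_le _ _).trans ?_
      gcongr
    have t3 : ‖(P - c • S - c • S') * S' ^ k‖ ≤ (1 - 2 * c) * 1 :=
      (norm_mul_le _ _).trans (by gcongr)
    rw [key]
    calc _ ≤ 1 * (1 - (k + 1) * c ^ k) + c ^ k * ((1 - c) * (1 * k) + (1 - 2 * c) * 1) := by
          refine (norm_add_le _ _).trans (add_le_add t1 ?_)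
          rw [norm_smul, Real.norm_of_nonneg hck]
          gcongr
          exact (norm_add_le _ _).trans (add_le_add t2 t3)
      _ = _ := by push_cast; ring

/-- If a contraction `P` dominates multiples of two commuting contractions `S`, `S'`, then
`P ^ n` asymptotically does not distinguish them. -/
lemma tendsto_norm_pow_mul_sub (h1 : ‖(1 : B)‖ ≤ 1) {P S S' : B} {c : ℝ} (hc : 0 < c)
    (hP : ‖P‖ ≤ 1) (hS : ‖S‖ ≤ 1) (hS' : ‖S'‖ ≤ 1) (hPS : ‖P - c • S‖ ≤ 1 - c)
    (hPSS : ‖P - c • S - c • S'‖ ≤ 1 - 2 * c)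
    (h₁ : Commute P S) (h₂ : Commute P S') (h₃ : Commute S S') :
    Tendsto (fun n => ‖P ^ n * (S - S')‖) atTop (𝓝 0) := by
  set a : ℕ → ℝ := fun n => ‖P ^ n * (S - S')‖ with ha
  have hanti : Antitone a := antitone_nat_of_succ_le fun n => by
    simp only [ha]
    rw [pow_succ', mul_assoc]
    exact (norm_mul_le _ _).trans (mul_le_of_le_one_left (norm_nonneg _) hP)
  have hbdd : BddBelow (Set.range a) := ⟨0, by rintro _ ⟨n, rfl⟩; exact norm_nonneg _⟩
  have hlim := tendsto_atTop_ciInf hanti hbdd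
  set l := ⨅ n, a n
  have hl0 : 0 ≤ l := ge_of_tendsto' hlim fun n => norm_nonneg _
  have step (k n : ℕ) : a (n + k) ≤ (1 - (k + 1) * c ^ k) * a n + c ^ k * 2 := by
    have hG := norm_pow_sub_geomTwo_le h1 hc.le hP hS hS' hPS hPSS k
    have key : P ^ (n + k) * (S - S') =
        (P ^ k - c ^ k • geomTwo S S' (k + 1)) * (P ^ n * (S - S'))
          + c ^ k • (P ^ n * (S ^ (k + 1) - S' ^ (k + 1))) := by
      rw [← geomTwo_mul_sub h₃, ← mul_assoc (P ^ n) (geomTwo _ _ _),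
        ((commute_geomTwo h₁ h₂ (k + 1)).pow_left n).eq, sub_mul, add_comm n k, pow_add]
      simp only [smul_mul_assoc, mul_assoc]
      abel
    simp only [ha]
    rw [key]
    refine (norm_add_le _ _).trans (add_le_add ?_ ?_)
    · exact (norm_mul_le _ _).trans (by gcongr)
    · rw [norm_smul, Real.norm_of_nonneg (by positivity)]
      gcongr
      refine (norm_mul_le _ _).trans ?_
      have := norm_sub_le (S ^ (k + 1)) (S' ^ (k + 1))
      have := norm_pow_le_one' h1 hS (k + 1)
      have := norm_pow_le_one' h1 hS' (k + 1)
      have := norm_pow_le_one' h1 hP n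
      calc _ ≤ 1 * (2 : ℝ) := by gcongr; linarith
        _ = 2 := one_mul _
  have hk (k : ℕ) : (k + 1) * l ≤ 2 := by
    have h := le_of_tendsto_of_tendsto' (hlim.comp (tendsto_add_atTop_nat k))
      ((hlim.const_mul (1 - (k + 1) * c ^ k)).add_const (c ^ k * 2)) (step k)
    have hck : 0 < c ^ k := by positivity
    by_contra! hcon
    nlinarith [mul_lt_mul_of_pos_left hcon hck]
  have : l = 0 := by
    by_contra hne
    obtain ⟨k, hk'⟩ := exists_nat_gt (2 / l)
    have hpos : 0 < l := lt_of_le_of_ne hl0 (Ne.symm hne)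
    rw [div_lt_iff₀ hpos] at hk'
    linarith [hk k]
  rwa [this] at hlim

end NormedAlgebra

section WalkOperator

variable {G B : Type*} [AddCommGroup G] [NormedRing B]

lemma AddChar.commute_apply (τ : AddChar G B) (γ γ' : G) : Commute (τ γ) (τ γ') := by
  rw [Commute, SemiconjBy, ← τ.map_add_eq_mul, ← τ.map_add_eq_mul, add_comm]

variable [NormedAlgebra ℝ B] {τ : AddChar G B} {w : ℕ → ℝ} {b : ℕ → G}

lemma norm_smul_addChar_le (hτ : ∀ γ, ‖τ γ‖ ≤ 1) {v : ℝ} (hv : 0 ≤ v) (γ : G) :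
    ‖v • τ γ‖ ≤ v := by
  rw [norm_smul, Real.norm_of_nonneg hv]
  exact mul_le_of_le_one_right hv (hτ γ)

/-- The average `∑ₖ wₖ τ(bₖ)` of a representation over the step law of a random walk. -/
def walkOp (τ : AddChar G B) (w : ℕ → ℝ) (b : ℕ → G) : B := ∑' k, w k • τ (b k)

variable [CompleteSpace B]

lemma hasSum_walkOp (hτ : ∀ γ, ‖τ γ‖ ≤ 1) (hw : ∀ k, 0 ≤ w k) (hs : Summable w) :
    HasSum (fun k => w k • τ (b k)) (walkOp τ w b) :=
  (Summable.of_norm_bounded hs fun k => norm_smul_addChar_le hτ (hw k) (b k)).hasSum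

lemma commute_walkOp_addChar (hτ : ∀ γ, ‖τ γ‖ ≤ 1) (hw : ∀ k, 0 ≤ w k) (hs : Summable w)
    (γ : G) : Commute (walkOp τ w b) (τ γ) := by
  have h := hasSum_walkOp (b := b) hτ hw hs
  refine (h.mul_right (τ γ)).unique ?_
  convert h.mul_left (τ γ) using 2 with k
  rw [smul_mul_assoc, mul_smul_comm, (τ.commute_apply _ _).eq]

lemma norm_walkOp_le (hτ : ∀ γ, ‖τ γ‖ ≤ 1) (hw : ∀ k, 0 ≤ w k) (hs : HasSum w 1) :
    ‖walkOp τ w b‖ ≤ 1 :=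
  (hasSum_walkOp hτ hw hs.summable).norm_le_of_bounded hs fun k =>
    norm_smul_addChar_le hτ (hw k) (b k)

lemma norm_walkOp_sub_le (hτ : ∀ γ, ‖τ γ‖ ≤ 1) (hw : ∀ k, 0 ≤ w k) (hs : HasSum w 1) {c : ℝ}
    {i : ℕ} (hi : c ≤ w i) : ‖walkOp τ w b - c • τ (b i)‖ ≤ 1 - c := by
  have h1 := (hasSum_walkOp (b := b) hτ hw hs.summable).sub (hasSum_ite_eq i (c • τ (b i)))
  refine h1.norm_le_of_bounded (hs.sub (hasSum_ite_eq i c)) fun k => ?_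
  by_cases hk : k = i
  · subst hk
    simp only [if_true]
    rw [← sub_smul]
    exact norm_smul_addChar_le hτ (by linarith) _
  · simp only [hk, if_false, sub_zero]
    exact norm_smul_addChar_le hτ (hw k) _

lemma norm_walkOp_sub_sub_le (hτ : ∀ γ, ‖τ γ‖ ≤ 1) (hw : ∀ k, 0 ≤ w k) (hs : HasSum w 1)
    {c : ℝ} {i j : ℕ} (hij : i ≠ j) (hi : c ≤ w i) (hj : c ≤ w j) :
    ‖walkOp τ w b - c • τ (b i) - c • τ (b j)‖ ≤ 1 - 2 * c := by
  have h1 := ((hasSum_walkOp (b := b) hτ hw hs.summable).sub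
    (hasSum_ite_eq i (c • τ (b i)))).sub (hasSum_ite_eq j (c • τ (b j)))
  have h2 := (hs.sub (hasSum_ite_eq i c)).sub (hasSum_ite_eq j c)
  rw [show 1 - 2 * c = 1 - c - c by ring]
  refine h1.norm_le_of_bounded h2 fun k => ?_
  by_cases hk : k = i
  · subst hk
    simp only [if_true, hij, if_false, sub_zero]
    rw [← sub_smul]
    exact norm_smul_addChar_le hτ (by linarith) _
  · by_cases hk' : k = j
    · subst hk'
      simp only [if_true, hk, if_false, sub_zero]
      rw [← sub_smul]
      exact norm_smul_addChar_le hτ (by linarith) _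
    · simp only [hk, hk', if_false, sub_zero]
      exact norm_smul_addChar_le hτ (hw k) _

/-- The laws of an aperiodic random walk are asymptotically translation invariant. -/
lemma tendsto_norm_walkOp_pow_mul (hτ : ∀ γ, ‖τ γ‖ ≤ 1) (hw : ∀ k, 0 ≤ w k) (hs : HasSum w 1)
    (hspan : AddSubgroup.closure {γ : G | ∃ i j, 0 < w i ∧ 0 < w j ∧ γ = b i - b j} = ⊤) (γ : G) :
    Tendsto (fun n => ‖walkOp τ w b ^ n * (τ γ - 1)‖) atTop (𝓝 0) := by
  have hγ : γ ∈ AddSubgroup.closure {γ : G | ∃ i j, 0 < w i ∧ 0 < w j ∧ γ = b i - b j} := by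
    rw [hspan]; trivial
  have h1 : ‖(1 : B)‖ ≤ 1 := τ.map_zero_eq_one ▸ hτ 0
  have bound (x : B) (n : ℕ) (δ : G) :
      ‖walkOp τ w b ^ n * (x * τ δ)‖ ≤ ‖walkOp τ w b ^ n * x‖ := by
    rw [← mul_assoc]
    exact (norm_mul_le _ _).trans (mul_le_of_le_one_right (norm_nonneg _) (hτ _))
  induction hγ using AddSubgroup.closure_induction with
  | mem γ h =>
    obtain ⟨i, j, hi, hj, rfl⟩ := h
    by_cases hij : i = j
    · subst hij
      simp
    have h := tendsto_norm_pow_mul_sub h1 (lt_min hi hj)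
      (norm_walkOp_le (b := b) hτ hw hs) (hτ (b i)) (hτ (b j))
      (norm_walkOp_sub_le hτ hw hs (min_le_left _ _))
      (norm_walkOp_sub_sub_le hτ hw hs hij (min_le_left _ _) (min_le_right _ _))
      (commute_walkOp_addChar hτ hw hs.summable _) (commute_walkOp_addChar hτ hw hs.summable _)
      (τ.commute_apply _ _)
    refine squeeze_zero (fun _ => norm_nonneg _) (fun n => ?_) h
    have : τ (b i - b j) - 1 = (τ (b i) - τ (b j)) * τ (-b j) := by
      rw [sub_mul, ← τ.map_add_eq_mul, ← τ.map_add_eq_mul, add_neg_cancel, τ.map_zero_eq_one,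
        sub_eq_add_neg (b i)]
    rw [this]
    exact bound _ _ _
  | zero => simp
  | add γ γ' _ _ h h' =>
    refine squeeze_zero (fun _ => norm_nonneg _) (fun n => ?_) (by simpa using h.add h')
    have : τ (γ + γ') - 1 = (τ γ - 1) * τ γ' + (τ γ' - 1) := by
      rw [sub_mul, ← τ.map_add_eq_mul, one_mul]; abel
    rw [this, mul_add]
    exact (norm_add_le _ _).trans (add_le_add (bound _ _ _) le_rfl)
  | neg γ _ h =>
    refine squeeze_zero (fun _ => norm_nonneg _) (fun n => ?_) h
    have : τ (-γ) - 1 = -((τ γ - 1) * τ (-γ)) := by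
      rw [sub_mul, ← τ.map_add_eq_mul, one_mul, add_neg_cancel, τ.map_zero_eq_one]; abel
    rw [this, mul_neg, norm_neg]
    exact bound _ _ _

end WalkOperator

section BanachRepresentation

variable {G E : Type*} [AddCommGroup G] [NormedAddCommGroup E] [NormedSpace ℝ E] [CompleteSpace E]
  {τ : AddChar G (E →L[ℝ] E)} {w : ℕ → ℝ} {b : ℕ → G}

/-- If an average of translates of `v` is close to a `P`-fixed vector `u`, then so is
`P ^ n v` for large `n`. -/
lemma eventually_norm_walkOp_pow_sub_le (hτ : ∀ γ, ‖τ γ‖ ≤ 1) (hw : ∀ k, 0 ≤ w k)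
    (hs : HasSum w 1)
    (hspan : AddSubgroup.closure {γ : G | ∃ i j, 0 < w i ∧ 0 < w j ∧ γ = b i - b j} = ⊤)
    {u v : E} (hu : walkOp τ w b u = u) {ε : ℝ} (hε : 0 < ε) {s : Finset G} (hne : s.Nonempty)
    (h : ‖(s.card : ℝ)⁻¹ • ∑ γ ∈ s, τ γ v - u‖ ≤ ε) :
    ∀ᶠ n in atTop, ‖(walkOp τ w b ^ n) v - u‖ ≤ 2 * ε := by
  set P := walkOp τ w b with hP
  have hcard : (0 : ℝ) < s.card := by exact_mod_cast hne.card_pos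
  set z := (s.card : ℝ)⁻¹ • ∑ γ ∈ s, τ γ v with hz
  have hzv : z - v = (s.card : ℝ)⁻¹ • ∑ γ ∈ s, (τ γ - 1) v := by
    simp only [sub_apply, one_apply_eq_self]
    rw [Finset.sum_sub_distrib, Finset.sum_const, smul_sub, ← Nat.cast_smul_eq_nsmul ℝ, smul_smul,
      inv_mul_cancel₀ hcard.ne', one_smul]
  have hlim : Tendsto (fun n => ‖(P ^ n) (z - v)‖) atTop (𝓝 0) := by
    have h0 : Tendsto (fun n => (s.card : ℝ)⁻¹ * ∑ γ ∈ s, ‖P ^ n * (τ γ - 1)‖ * ‖v‖) atTop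
        (𝓝 0) := by
      have := (tendsto_finsetSum s fun γ _ =>
        (tendsto_norm_walkOp_pow_mul hτ hw hs hspan γ).mul_const ‖v‖).const_mul (s.card : ℝ)⁻¹
      simpa using this
    refine squeeze_zero (fun _ => norm_nonneg _) (fun n => ?_) h0
    rw [hzv, map_smul, map_sum, norm_smul, Real.norm_of_nonneg (by positivity)]
    gcongr
    refine (norm_sum_le _ _).trans (Finset.sum_le_sum fun γ _ => ?_)
    exact (P ^ n * (τ γ - 1)).le_opNorm v
  have hPu (n : ℕ) : (P ^ n) u = u := by
    induction n with
    | zero => rfl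
    | succ n ih => rw [pow_succ, mul_apply_eq_comp, hu, ih]
  filter_upwards [hlim.eventually_le_const hε] with n hn
  have hpow : ‖P ^ n‖ ≤ 1 :=
    norm_pow_le_one' ContinuousLinearMap.norm_id_le (norm_walkOp_le hτ hw hs) n
  have key : (P ^ n) v - u = (P ^ n) (z - u) - (P ^ n) (z - v) := by
    rw [map_sub, map_sub, hPu]
    abel
  rw [key, two_mul]
  refine (norm_sub_le _ _).trans (add_le_add ?_ hn)
  calc _ ≤ ‖P ^ n‖ * ‖z - u‖ := ContinuousLinearMap.le_opNorm _ _
    _ ≤ 1 * ε := by gcongr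
    _ = ε := one_mul _

/-- Translating the `k`-th component of a convex combination by `b k` is asymptotically
invisible to `P ^ n`. -/
lemma tendsto_norm_walkOp_pow_apply (hτ : ∀ γ, ‖τ γ‖ ≤ 1) (hw : ∀ k, 0 ≤ w k) (hs : HasSum w 1)
    (hspan : AddSubgroup.closure {γ : G | ∃ i j, 0 < w i ∧ 0 < w j ∧ γ = b i - b j} = ⊤)
    {L : ℕ → E} {C : ℝ} (hL : ∀ k, ‖L k‖ ≤ C) :
    Tendsto (fun n => ‖(walkOp τ w b ^ n) (∑' k, w k • (τ (b k) - 1) (L k))‖) atTop (𝓝 0) ∧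
      Summable fun k => w k • (τ (b k) - 1) (L k) := by
  set P := walkOp τ w b with hP
  have h1 : ‖(1 : E →L[ℝ] E)‖ ≤ 1 := ContinuousLinearMap.norm_id_le
  have hτ2 (k : ℕ) : ‖τ (b k) - 1‖ ≤ 2 := by
    refine (norm_sub_le _ _).trans ?_
    linarith [hτ (b k)]
  have hsum : Summable fun k => w k * (2 * C) := hs.summable.mul_right _
  have hT (k : ℕ) : ‖w k • (τ (b k) - 1) (L k)‖ ≤ w k * (2 * C) := by
    rw [norm_smul, Real.norm_of_nonneg (hw k)]
    refine mul_le_mul_of_nonneg_left ((ContinuousLinearMap.le_opNorm _ _).trans ?_) (hw k)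
    exact mul_le_mul (hτ2 k) (hL k) (norm_nonneg _) zero_le_two
  have hS : Summable fun k => w k • (τ (b k) - 1) (L k) := Summable.of_norm_bounded hsum hT
  refine ⟨?_, hS⟩
  have hlim : Tendsto (fun n => ∑' k, (P ^ n) (w k • (τ (b k) - 1) (L k))) atTop
      (𝓝 (∑' _ : ℕ, (0 : E))) := by
    refine tendsto_tsum_of_dominated_convergence hsum (fun k => ?_)
      (Eventually.of_forall fun n k => ?_)
    · rw [tendsto_zero_iff_norm_tendsto_zero]
      have h := (tendsto_norm_walkOp_pow_mul hτ hw hs hspan (b k)).mul_const (w k * ‖L k‖)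
      rw [zero_mul] at h
      refine squeeze_zero (fun _ => norm_nonneg _) (fun n => ?_) h
      rw [map_smul, norm_smul, Real.norm_of_nonneg (hw k), mul_left_comm]
      exact mul_le_mul_of_nonneg_left ((P ^ n * (τ (b k) - 1)).le_opNorm (L k)) (hw k)
    · calc _ ≤ ‖P ^ n‖ * ‖w k • (τ (b k) - 1) (L k)‖ := ContinuousLinearMap.le_opNorm _ _
        _ ≤ 1 * (w k * (2 * C)) := by
          gcongr
          exacts [norm_pow_le_one' h1 (norm_walkOp_le hτ hw hs) n, hT k]
        _ = _ := one_mul _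
  rw [tsum_zero] at hlim
  convert hlim.norm using 2 with n
  · rw [(hS.hasSum.mapL (P ^ n)).tsum_eq]
  · simp

end BanachRepresentation

section Shift

open scoped BoundedContinuousFunction

/-- The Banach space of bounded functions on a discrete space. -/
def BddFun (G : Type*) [TopologicalSpace G] : Type _ := G →ᵇ ℝ

namespace BddFun

section Space

variable {G : Type*} [TopologicalSpace G]

instance : NormedAddCommGroup (BddFun G) :=
  inferInstanceAs (NormedAddCommGroup (G →ᵇ ℝ))

instance : NormedSpace ℝ (BddFun G) := inferInstanceAs (NormedSpace ℝ (G →ᵇ ℝ))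

instance : CompleteSpace (BddFun G) := inferInstanceAs (CompleteSpace (G →ᵇ ℝ))

instance : CoeFun (BddFun G) fun _ => G → ℝ := ⟨fun φ => (show G →ᵇ ℝ from φ)⟩

@[ext] lemma ext {φ ψ : BddFun G} (h : ∀ α, φ α = ψ α) : φ = ψ :=
  BoundedContinuousFunction.ext h

lemma norm_le {φ : BddFun G} {C : ℝ} (hC : 0 ≤ C) : ‖φ‖ ≤ C ↔ ∀ α, ‖φ α‖ ≤ C :=
  BoundedContinuousFunction.norm_le hC

lemma norm_apply_le (φ : BddFun G) (α : G) : ‖φ α‖ ≤ ‖φ‖ :=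
  BoundedContinuousFunction.norm_coe_le_norm φ α

/-- Evaluation at a point. -/
def eval (α : G) : BddFun G →L[ℝ] ℝ := BoundedContinuousFunction.evalCLM ℝ α

end Space

variable {G : Type*} [AddCommGroup G] [TopologicalSpace G] [DiscreteTopology G]

/-- A bounded function as an element of `BddFun G`. -/
def mk (f : G → ℝ) (C : ℝ) (h : ∀ α, ‖f α‖ ≤ C) : BddFun G :=
  BoundedContinuousFunction.ofNormedAddCommGroupDiscrete f C h

/-- The translation operator `φ ↦ φ (· + γ)`, as a linear map. -/
def shiftLin (γ : G) : BddFun G →ₗ[ℝ] BddFun G where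
  toFun φ := mk (fun α => φ (α + γ)) ‖φ‖ fun _ => norm_apply_le φ _
  map_add' _ _ := rfl
  map_smul' _ _ := rfl

lemma norm_shiftLin_le (γ : G) (φ : BddFun G) : ‖shiftLin γ φ‖ ≤ 1 * ‖φ‖ := by
  rw [one_mul]
  exact (norm_le (norm_nonneg _)).2 fun α => norm_apply_le φ _

/-- The translation operators, as a representation on bounded functions. -/
def shift (G : Type*) [AddCommGroup G] [TopologicalSpace G]
    [DiscreteTopology G] : AddChar G (BddFun G →L[ℝ] BddFun G) where
  toFun γ := (shiftLin γ).mkContinuous 1 (norm_shiftLin_le γ)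
  map_zero_eq_one' := ContinuousLinearMap.ext fun φ => ext fun α =>
    show φ (α + 0) = φ α by rw [add_zero]
  map_add_eq_mul' γ γ' := ContinuousLinearMap.ext fun φ => ext fun α =>
    show φ (α + (γ + γ')) = φ (α + γ + γ') by rw [add_assoc]

lemma norm_shift_le (γ : G) : ‖shift G γ‖ ≤ 1 :=
  LinearMap.mkContinuous_norm_le (shiftLin γ) zero_le_one (norm_shiftLin_le γ)

variable {w : ℕ → ℝ} {b : ℕ → G}

lemma hasSum_walkOp_apply (hw : ∀ k, 0 ≤ w k) (hs : Summable w) (φ : BddFun G) (α : G) :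
    HasSum (fun k => w k * φ (α + b k)) (walkOp (shift G) w b φ α) :=
  (hasSum_walkOp norm_shift_le hw hs).mapL
    ((eval α).comp (ContinuousLinearMap.apply ℝ (BddFun G) φ))

/-- If the averages of `Φ` over all translates of a finite set are close to `A`, then so are
all values of `P ^ n Φ` for large `n`. -/
lemma eventually_abs_walkOp_pow_sub_le (hw : ∀ k, 0 ≤ w k) (hs : HasSum w 1)
    (hspan : AddSubgroup.closure {γ : G | ∃ i j, 0 < w i ∧ 0 < w j ∧ γ = b i - b j} = ⊤)
    {Φ : BddFun G} {A ε : ℝ} (hε : 0 < ε) {s : Finset G} (hne : s.Nonempty)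
    (h : ∀ α, |(∑ γ ∈ s, Φ (α + γ)) / s.card - A| ≤ ε) :
    ∀ᶠ n in atTop, ∀ α, |(walkOp (shift G) w b ^ n) Φ α - A| ≤ 2 * ε := by
  set u : BddFun G := mk (fun _ => A) |A| fun _ => le_rfl with hu_def
  have hu : walkOp (shift G) w b u = u := ext fun α => by
    refine (hasSum_walkOp_apply hw hs.summable _ α).unique ?_
    have := hs.mul_right A
    rwa [one_mul] at this
  have hM : ‖(s.card : ℝ)⁻¹ • ∑ γ ∈ s, shift G γ Φ - u‖ ≤ ε := by
    refine (norm_le hε.le).2 fun α => ?_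
    have h1 : eval α ((s.card : ℝ)⁻¹ • ∑ γ ∈ s, shift G γ Φ - u)
        = (∑ γ ∈ s, Φ (α + γ)) / s.card - A := by
      rw [map_sub, map_smul, map_sum, div_eq_inv_mul]
      rfl
    exact (congrArg norm h1).trans_le (h α)
  filter_upwards [eventually_norm_walkOp_pow_sub_le norm_shift_le hw hs hspan hu hε hne hM]
    with n hn α
  exact (norm_apply_le _ α).trans hn

lemma tendsto_norm_walkOp_pow_sub (hw : ∀ k, 0 ≤ w k) (hs : HasSum w 1)
    (hspan : AddSubgroup.closure {γ : G | ∃ i j, 0 < w i ∧ 0 < w j ∧ γ = b i - b j} = ⊤)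
    {L : ℕ → BddFun G} {C : ℝ} (hL : ∀ k, ‖L k‖ ≤ C) {Φ₀ Φ₁ : BddFun G}
    (h₀ : ∀ α, HasSum (fun k => w k * L k α) (Φ₀ α))
    (h₁ : ∀ α, HasSum (fun k => w k * L k (α + b k)) (Φ₁ α)) :
    Tendsto (fun n => ‖(walkOp (shift G) w b ^ n) (Φ₁ - Φ₀)‖) atTop (𝓝 0) := by
  obtain ⟨hlim, hS⟩ := tendsto_norm_walkOp_pow_apply norm_shift_le hw hs hspan hL
  convert hlim
  refine ext fun α => ((h₁ α).sub (h₀ α)).unique ?_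
  have h : HasSum (fun k => w k * (L k (α + b k) - L k α)) _ := hS.hasSum.mapL (eval α)
  simp only [mul_sub] at h
  exact h

end BddFun

end Shift

/-- Lebesgue measure on the unit interval. -/
abbrev unitLeb : Measure ℝ := volume.restrict (Set.Ico (0 : ℝ) 1)

instance : IsProbabilityMeasure unitLeb := ⟨by simp⟩

namespace RW

variable {d : ℕ} (R : RW d)

/-- The probability of the `k`-th direction. -/
abbrev wt (k : ℕ) : ℝ := R.p (R.e k)

lemma wt_nonneg (k : ℕ) : 0 ≤ R.wt k := R.nonneg _

lemma hasSum_wt : HasSum R.wt 1 := (Equiv.hasSum_iff R.e).2 R.total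

lemma q_zero : R.q 0 = 0 := by simp [q]

lemma q_succ (k : ℕ) : R.q (k + 1) = R.q k + R.wt k := Finset.sum_range_succ _ _

lemma monotone_q : Monotone R.q :=
  monotone_nat_of_le_succ fun k => by rw [q_succ]; linarith [R.wt_nonneg k]

lemma tendsto_q : Tendsto R.q atTop (𝓝 1) := R.hasSum_wt.tendsto_sum_nat

lemma q_nonneg (k : ℕ) : 0 ≤ R.q k := R.q_zero ▸ R.monotone_q (Nat.zero_le k)

lemma q_le_one (k : ℕ) : R.q k ≤ 1 := R.monotone_q.ge_of_tendsto R.tendsto_q k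

lemma idx_eq {y : ℝ} {k : ℕ} (hy : y ∈ Set.Ico (R.q k) (R.q (k + 1))) : R.idx y = k := by
  have : {j | R.q j ≤ y} = Set.Iic k := by
    ext j
    refine ⟨fun hj => ?_, fun hj => (R.monotone_q hj).trans hy.1⟩
    by_contra hjk
    have : R.q (k + 1) ≤ R.q j := R.monotone_q (by simpa using hjk)
    exact absurd hy.2 (not_lt.2 (this.trans hj))
  rw [idx, this, csSup_Iic]

lemma exists_mem_Ico_q {y : ℝ} (hy : y ∈ Set.Ico (0 : ℝ) 1) :
    ∃ k, y ∈ Set.Ico (R.q k) (R.q (k + 1)) := by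
  classical
  have h : ∃ k, y < R.q k := (R.tendsto_q.eventually_const_lt hy.2).exists
  have h0 : Nat.find h ≠ 0 := fun h0 => by
    have := Nat.find_spec h
    rw [h0, q_zero] at this
    exact absurd hy.1 (not_le.2 this)
  obtain ⟨k, hk⟩ := Nat.exists_eq_succ_of_ne_zero h0
  refine ⟨k, not_lt.1 (Nat.find_min h (by omega)), ?_⟩
  have := Nat.find_spec h
  rwa [hk] at this

lemma mem_Ico_idx {y : ℝ} (hy : y ∈ Set.Ico (0 : ℝ) 1) :
    y ∈ Set.Ico (R.q (R.idx y)) (R.q (R.idx y + 1)) := by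
  obtain ⟨k, hk⟩ := R.exists_mem_Ico_q hy
  rwa [R.idx_eq hk]

lemma wt_idx_pos {y : ℝ} (hy : y ∈ Set.Ico (0 : ℝ) 1) : 0 < R.wt (R.idx y) := by
  have h := R.mem_Ico_idx hy
  rw [q_succ] at h
  linarith [h.1, h.2]

lemma iUnion_Ico_q : ⋃ k, Set.Ico (R.q k) (R.q (k + 1)) = Set.Ico (0 : ℝ) 1 := by
  ext y
  simp only [Set.mem_iUnion]
  refine ⟨fun ⟨k, hk⟩ => ⟨(R.q_nonneg k).trans hk.1, hk.2.trans_le (R.q_le_one _)⟩,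
    R.exists_mem_Ico_q⟩

lemma idx_eq_zero {y : ℝ} (hy : y ∉ Set.Ico (0 : ℝ) 1) : R.idx y = 0 := by
  by_cases h0 : 0 ≤ y
  · have h1 : 1 ≤ y := not_lt.1 fun h => hy ⟨h0, h⟩
    have : {j | R.q j ≤ y} = Set.univ := Set.eq_univ_of_forall fun j => (R.q_le_one j).trans h1
    rw [idx, this]
    exact Nat.sSup_of_not_bddAbove not_bddAbove_univ
  · have : {j | R.q j ≤ y} = ∅ :=
      Set.eq_empty_of_forall_notMem fun j hj => h0 ((R.q_nonneg j).trans hj)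
    rw [idx, this, csSup_empty, Nat.bot_eq_zero]

lemma measurable_idx : Measurable R.idx := by
  refine measurable_to_countable' fun k => ?_
  have : R.idx ⁻¹' {k} =
      Set.Ico (R.q k) (R.q (k + 1)) ∪ ((Set.Ico (0 : ℝ) 1)ᶜ ∩ {_y | k = 0}) := by
    ext y
    simp only [Set.mem_preimage, Set.mem_singleton_iff, Set.mem_union, Set.mem_inter_iff,
      Set.mem_compl_iff, Set.mem_ofPred_eq]
    constructor
    · rintro rfl
      by_cases hy : y ∈ Set.Ico (0 : ℝ) 1
      · exact Or.inl (R.mem_Ico_idx hy)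
      · exact Or.inr ⟨hy, R.idx_eq_zero hy⟩
    · rintro (h | ⟨h, rfl⟩)
      · exact R.idx_eq h
      · exact R.idx_eq_zero h
  rw [this]
  exact measurableSet_Ico.union (measurableSet_Ico.compl.inter (MeasurableSet.const _))

lemma measurable_p : Measurable R.p := measurable_of_countable _

lemma measurable_T : Measurable R.T := by
  have hi : Measurable fun x : RWSpace d => R.idx x.2.1 := R.measurable_idx.comp (by fun_prop)
  have he : Measurable fun x : RWSpace d => R.e (R.idx x.2.1) :=
    (measurable_of_countable R.e).comp hi
  have hp : Measurable fun x : RWSpace d => R.p (R.e (R.idx x.2.1)) := R.measurable_p.comp he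
  have hq : Measurable fun x : RWSpace d => R.q (R.idx x.2.1) :=
    (measurable_of_countable R.q).comp hi
  unfold T
  exact (measurable_fst.add he).prodMk (((measurable_fst.comp measurable_snd).sub hq).div hp
    |>.prodMk ((hp.mul (measurable_snd.comp measurable_snd)).add hq))

lemma measurable_Tinv : Measurable R.Tinv := by
  have hi : Measurable fun x : RWSpace d => R.idx x.2.2 := R.measurable_idx.comp (by fun_prop)
  have he : Measurable fun x : RWSpace d => R.e (R.idx x.2.2) :=
    (measurable_of_countable R.e).comp hi
  have hp : Measurable fun x : RWSpace d => R.p (R.e (R.idx x.2.2)) := R.measurable_p.comp he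
  have hq : Measurable fun x : RWSpace d => R.q (R.idx x.2.2) :=
    (measurable_of_countable R.q).comp hi
  unfold Tinv
  exact (measurable_fst.sub he).prodMk (((hp.mul (measurable_fst.comp measurable_snd)).add hq)
    |>.prodMk (((measurable_snd.comp measurable_snd).sub hq).div hp))

lemma affine_image_Ico {k : ℕ} (hk : 0 < R.wt k) :
    (fun u => R.wt k * u + R.q k) '' Set.Ico (0 : ℝ) 1 = Set.Ico (R.q k) (R.q (k + 1)) := by
  rw [Set.image_affine_Ico hk, q_succ]
  congr 1 <;> ring

lemma affine_mem_Ico {k : ℕ} (hk : 0 < R.wt k) {u : ℝ} (hu : u ∈ Set.Ico (0 : ℝ) 1) :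
    R.wt k * u + R.q k ∈ Set.Ico (R.q k) (R.q (k + 1)) :=
  R.affine_image_Ico hk ▸ Set.mem_image_of_mem _ hu

lemma pairwise_disjoint_Ico_q :
    Pairwise (Function.onFun Disjoint fun k => Set.Ico (R.q k) (R.q (k + 1))) :=
  R.monotone_q.pairwise_disjoint_on_Ico_succ

lemma affine_injOn {k : ℕ} (hk : 0 < R.wt k) :
    Set.InjOn (fun u => R.wt k * u + R.q k) (Set.Ico (0 : ℝ) 1) :=
  fun u _ v _ huv => by simpa [hk.ne'] using huv

lemma affine_hasDerivWithinAt (k : ℕ) (u : ℝ) :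
    HasDerivWithinAt (fun u => R.wt k * u + R.q k) (R.wt k) (Set.Ico (0 : ℝ) 1) u := by
  simpa using (((hasDerivAt_id u).const_mul (R.wt k)).add_const (R.q k)).hasDerivWithinAt

lemma lintegral_idx (h : ℕ → ℝ → ENNReal) :
    ∫⁻ y, h (R.idx y) y ∂unitLeb =
      ∑' k, ENNReal.ofReal (R.wt k) * ∫⁻ u, h k (R.wt k * u + R.q k) ∂unitLeb := by
  have hU := lintegral_iUnion (μ := volume) (fun _ => measurableSet_Ico) R.pairwise_disjoint_Ico_q
    fun y => h (R.idx y) y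
  rw [R.iUnion_Ico_q] at hU
  rw [hU]
  refine tsum_congr fun k => ?_
  rw [setLIntegral_congr_fun (g := h k) measurableSet_Ico fun y hy => by simp only [R.idx_eq hy]]
  rcases (R.wt_nonneg k).eq_or_lt with hk | hk
  · simp [q_succ, ← hk]
  · rw [← R.affine_image_Ico hk, lintegral_image_eq_lintegral_abs_deriv_mul measurableSet_Ico
      (fun u _ => R.affine_hasDerivWithinAt k u) (R.affine_injOn hk), abs_of_pos hk,
      lintegral_const_mul' _ _ ENNReal.ofReal_ne_top]

lemma hasSum_integral_idx {h : ℕ → ℝ → ℝ} (hint : Integrable (fun y => h (R.idx y) y) unitLeb) :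
    HasSum (fun k => R.wt k * ∫ u, h k (R.wt k * u + R.q k) ∂unitLeb)
      (∫ y, h (R.idx y) y ∂unitLeb) := by
  have hs := hasSum_integral_iUnion (μ := volume) (f := fun y => h (R.idx y) y)
    (fun k => measurableSet_Ico) R.pairwise_disjoint_Ico_q (by rw [R.iUnion_Ico_q]; exact hint)
  rw [R.iUnion_Ico_q] at hs
  suffices key : ∀ k, ∫ y in Set.Ico (R.q k) (R.q (k + 1)), h (R.idx y) y =
      R.wt k * ∫ u, h k (R.wt k * u + R.q k) ∂unitLeb by simpa only [key] using hs
  intro k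
  rw [setIntegral_congr_fun (g := h k) measurableSet_Ico fun y hy => by simp only [R.idx_eq hy]]
  rcases (R.wt_nonneg k).eq_or_lt with hk | hk
  · simp [q_succ, ← hk]
  · rw [← R.affine_image_Ico hk, integral_image_eq_integral_abs_deriv_smul measurableSet_Ico
      (fun u _ => R.affine_hasDerivWithinAt k u) (R.affine_injOn hk), abs_of_pos hk]
    simp [integral_const_mul]

end RW

/-- The part of the phase space that carries the invariant measure. -/
def unitCells (d : ℕ) : Set (RWSpace d) :=
  {x | x.2.1 ∈ Set.Ico (0 : ℝ) 1 ∧ x.2.2 ∈ Set.Ico (0 : ℝ) 1}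

lemma ae_mem_unitCells (d : ℕ) : ∀ᵐ x ∂rwMeasure d, x ∈ unitCells d := by
  have h : rwMeasure d = ((Measure.count : Measure (Fin d → ℤ)).prod
      (volume.prod volume)).restrict (Set.univ ×ˢ (Set.Ico (0 : ℝ) 1 ×ˢ Set.Ico (0 : ℝ) 1)) := by
    rw [rwMeasure, ← Measure.prod_restrict, ← Measure.prod_restrict, Measure.restrict_univ]
  rw [h]
  filter_upwards [ae_restrict_mem (MeasurableSet.univ.prod
    (measurableSet_Ico.prod measurableSet_Ico))] with x hx
  exact hx.2

lemma lintegral_rwMeasure {d : ℕ} {f : RWSpace d → ENNReal} (hf : Measurable f) :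
    ∫⁻ x, f x ∂rwMeasure d = ∑' α, ∫⁻ y₁, ∫⁻ y₂, f (α, y₁, y₂) ∂unitLeb ∂unitLeb := by
  rw [rwMeasure, lintegral_prod _ hf.aemeasurable, lintegral_count]
  refine tsum_congr fun α => ?_
  exact lintegral_prod (fun y => f (α, y)) (hf.comp measurable_prodMk_left).aemeasurable

namespace RW

variable {d : ℕ} (R : RW d)

lemma normalize_mem_Ico {y : ℝ} (hy : y ∈ Set.Ico (0 : ℝ) 1) :
    (y - R.q (R.idx y)) / R.p (R.e (R.idx y)) ∈ Set.Ico (0 : ℝ) 1 := by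
  have h := R.mem_Ico_idx hy
  have hp : 0 < R.p (R.e (R.idx y)) := R.wt_idx_pos hy
  rw [q_succ] at h
  refine ⟨div_nonneg (by linarith [h.1]) hp.le, ?_⟩
  rw [div_lt_one hp]
  linarith [h.2]

lemma Ico_q_subset (k : ℕ) : Set.Ico (R.q k) (R.q (k + 1)) ⊆ Set.Ico (0 : ℝ) 1 :=
  R.iUnion_Ico_q ▸ Set.subset_iUnion (fun k => Set.Ico (R.q k) (R.q (k + 1))) k

lemma T_mem {x : RWSpace d} (hx : x ∈ unitCells d) : R.T x ∈ unitCells d :=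
  ⟨R.normalize_mem_Ico hx.1, R.Ico_q_subset _ (R.affine_mem_Ico (R.wt_idx_pos hx.1) hx.2)⟩

lemma Tinv_mem {x : RWSpace d} (hx : x ∈ unitCells d) : R.Tinv x ∈ unitCells d :=
  ⟨R.Ico_q_subset _ (R.affine_mem_Ico (R.wt_idx_pos hx.2) hx.1), R.normalize_mem_Ico hx.2⟩

lemma Tinv_T {x : RWSpace d} (hx : x ∈ unitCells d) : R.Tinv (R.T x) = x := by
  have hp := R.wt_idx_pos hx.1
  have hk : R.idx (R.T x).2.2 = R.idx x.2.1 := R.idx_eq (R.affine_mem_Ico hp hx.2)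
  have hp' : R.p (R.e (R.idx x.2.1)) ≠ 0 := hp.ne'
  unfold Tinv
  rw [hk]
  ext
  · simp [T]
  · simp only [T]
    field_simp
    ring
  · simp only [T]
    field_simp
    ring

lemma T_Tinv {x : RWSpace d} (hx : x ∈ unitCells d) : R.T (R.Tinv x) = x := by
  have hp := R.wt_idx_pos hx.2
  have hk : R.idx (R.Tinv x).2.1 = R.idx x.2.2 := R.idx_eq (R.affine_mem_Ico hp hx.1)
  have hp' : R.p (R.e (R.idx x.2.2)) ≠ 0 := hp.ne'
  unfold T
  rw [hk]
  ext
  · simp [Tinv]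
  · simp only [Tinv]
    field_simp
    ring
  · simp only [Tinv]
    field_simp
    ring

lemma T_iterate_mem (n : ℕ) {x : RWSpace d} (hx : x ∈ unitCells d) : R.T^[n] x ∈ unitCells d :=
  (show Set.MapsTo R.T (unitCells d) (unitCells d) from fun _ => R.T_mem).iterate n hx

lemma Tinv_iterate_mem (n : ℕ) {x : RWSpace d} (hx : x ∈ unitCells d) :
    R.Tinv^[n] x ∈ unitCells d :=
  (show Set.MapsTo R.Tinv (unitCells d) (unitCells d) from fun _ => R.Tinv_mem).iterate n hx

lemma Tinv_iterate_T_iterate (n : ℕ) {x : RWSpace d} (hx : x ∈ unitCells d) :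
    R.Tinv^[n] (R.T^[n] x) = x := by
  induction n with
  | zero => rfl
  | succ n ih =>
    rw [Function.iterate_succ_apply' R.T, Function.iterate_succ_apply,
      R.Tinv_T (R.T_iterate_mem n hx), ih]

lemma T_iterate_Tinv_iterate (n : ℕ) {x : RWSpace d} (hx : x ∈ unitCells d) :
    R.T^[n] (R.Tinv^[n] x) = x := by
  induction n with
  | zero => rfl
  | succ n ih =>
    rw [Function.iterate_succ_apply' R.Tinv, Function.iterate_succ_apply,
      R.T_Tinv (R.Tinv_iterate_mem n hx), ih]

lemma lintegral_T {f : RWSpace d → ENNReal} (hf : Measurable f) :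
    ∫⁻ x, f (R.T x) ∂rwMeasure d = ∫⁻ x, f x ∂rwMeasure d := by
  rw [lintegral_rwMeasure (f := fun x => f (R.T x)) (hf.comp R.measurable_T), lintegral_rwMeasure hf]
  have hfα (α : Fin d → ℤ) : Measurable fun y : ℝ × ℝ => f (α, y.1, y.2) :=
    hf.comp measurable_prodMk_left
  have hk (α : Fin d → ℤ) (k : ℕ) :
      Measurable fun u => ∫⁻ y₂, f (α, u, R.wt k * y₂ + R.q k) ∂unitLeb :=
    Measurable.lintegral_prod_right' (f := fun z : ℝ × ℝ => f (α, z.1, R.wt k * z.2 + R.q k))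
      ((hfα α).comp (by fun_prop : Measurable fun z : ℝ × ℝ => (z.1, R.wt k * z.2 + R.q k)))
  have h1 (α : Fin d → ℤ) : ∫⁻ y₁, ∫⁻ y₂, f (R.T (α, y₁, y₂)) ∂unitLeb ∂unitLeb =
      ∑' k, ENNReal.ofReal (R.wt k) *
        ∫⁻ u, ∫⁻ y₂, f (α + R.e k, u, R.wt k * y₂ + R.q k) ∂unitLeb ∂unitLeb := by
    have := R.lintegral_idx fun k y => ∫⁻ y₂, f (α + R.e k, (y - R.q k) / R.p (R.e k),
      R.wt k * y₂ + R.q k) ∂unitLeb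
    refine this.trans (tsum_congr fun k => ?_)
    rcases (R.wt_nonneg k).eq_or_lt with hk | hk
    · simp [← hk]
    · simp only [add_sub_cancel_right, mul_div_cancel_left₀ _ hk.ne']
  have h2 (α : Fin d → ℤ) : ∫⁻ y₁, ∫⁻ y₂, f (α, y₁, y₂) ∂unitLeb ∂unitLeb =
      ∑' k, ENNReal.ofReal (R.wt k) *
        ∫⁻ u, ∫⁻ y₂, f (α, u, R.wt k * y₂ + R.q k) ∂unitLeb ∂unitLeb := by
    simp only [fun y₁ => R.lintegral_idx fun _ y₂ => f (α, y₁, y₂)]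
    rw [lintegral_tsum fun k => ((hk α k).const_mul _).aemeasurable]
    simp only [lintegral_const_mul' _ _ ENNReal.ofReal_ne_top]
  calc _ = ∑' α, ∑' k, ENNReal.ofReal (R.wt k) *
        ∫⁻ u, ∫⁻ y₂, f (α + R.e k, u, R.wt k * y₂ + R.q k) ∂unitLeb ∂unitLeb :=
        tsum_congr h1
    _ = ∑' k, ∑' α, ENNReal.ofReal (R.wt k) *
        ∫⁻ u, ∫⁻ y₂, f (α + R.e k, u, R.wt k * y₂ + R.q k) ∂unitLeb ∂unitLeb :=
        ENNReal.tsum_comm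
    _ = ∑' k, ∑' α, ENNReal.ofReal (R.wt k) *
        ∫⁻ u, ∫⁻ y₂, f (α, u, R.wt k * y₂ + R.q k) ∂unitLeb ∂unitLeb :=
        tsum_congr fun k => (Equiv.addRight (R.e k)).tsum_eq fun α => ENNReal.ofReal (R.wt k) *
          ∫⁻ u, ∫⁻ y₂, f (α, u, R.wt k * y₂ + R.q k) ∂unitLeb ∂unitLeb
    _ = ∑' α, ∑' k, ENNReal.ofReal (R.wt k) *
        ∫⁻ u, ∫⁻ y₂, f (α, u, R.wt k * y₂ + R.q k) ∂unitLeb ∂unitLeb := ENNReal.tsum_comm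
    _ = _ := tsum_congr fun α => (h2 α).symm

lemma measurePreserving_T : MeasurePreserving R.T (rwMeasure d) (rwMeasure d) := by
  refine ⟨R.measurable_T, Measure.ext_of_lintegral _ fun f hf => ?_⟩
  rw [lintegral_map hf R.measurable_T, R.lintegral_T hf]

end RW

namespace RW

variable {d : ℕ} (R : RW d)

lemma ae_unitLeb_mem : ∀ᵐ y ∂unitLeb, y ∈ Set.Ico (0 : ℝ) 1 := ae_restrict_mem measurableSet_Ico

lemma measurePreserving_Tinv : MeasurePreserving R.Tinv (rwMeasure d) (rwMeasure d) := by
  refine ⟨R.measurable_Tinv, ?_⟩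
  conv_lhs => rw [← R.measurePreserving_T.map_eq, Measure.map_map R.measurable_Tinv R.measurable_T]
  have h : R.Tinv ∘ R.T =ᵐ[rwMeasure d] id := by
    filter_upwards [ae_mem_unitCells d] with x hx using R.Tinv_T hx
  rw [Measure.map_congr h, Measure.map_id]

lemma integral_Tinv_iterate (n : ℕ) {f : RWSpace d → ℝ} (hf : Measurable f) :
    ∫ x, f (R.Tinv^[n] x) ∂rwMeasure d = ∫ x, f x ∂rwMeasure d := by
  have h := R.measurePreserving_Tinv.iterate n
  conv_rhs => rw [← h.map_eq]
  exact (integral_map h.measurable.aemeasurable hf.aestronglyMeasurable).symm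

end RW

section CellAverages

variable {d : ℕ}

/-- The average of a function over the unit square at `α`. -/
def cellAvg (f : RWSpace d → ℝ) (α : Fin d → ℤ) : ℝ :=
  ∫ y₁, ∫ y₂, f (α, y₁, y₂) ∂unitLeb ∂unitLeb

lemma norm_integral_unitLeb_le {f : ℝ → ℝ} {C : ℝ} (hC : ∀ y, |f y| ≤ C) :
    ‖∫ y, f y ∂unitLeb‖ ≤ C := by
  simpa using norm_integral_le_of_norm_le_const (μ := unitLeb) (f := f) (C := C) (.of_forall hC)

lemma norm_cellAvg_le {f : RWSpace d → ℝ} {C : ℝ} (hC : ∀ x, |f x| ≤ C) (α : Fin d → ℤ) :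
    ‖cellAvg f α‖ ≤ C :=
  norm_integral_unitLeb_le fun _ => norm_integral_unitLeb_le fun _ => hC _

lemma integrable_cell {f : RWSpace d → ℝ} {C : ℝ} (hf : Measurable f) (hC : ∀ x, |f x| ≤ C)
    (α : Fin d → ℤ) : Integrable (fun y : ℝ × ℝ => f (α, y)) (unitLeb.prod unitLeb) :=
  Integrable.of_bound (hf.comp measurable_prodMk_left).aestronglyMeasurable C
    (.of_forall fun _ => hC _)

lemma cellAvg_eq_integral_prod {f : RWSpace d → ℝ} {C : ℝ} (hf : Measurable f)
    (hC : ∀ x, |f x| ≤ C) (α : Fin d → ℤ) :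
    cellAvg f α = ∫ y, f (α, y) ∂unitLeb.prod unitLeb :=
  (integral_prod _ (integrable_cell hf hC α)).symm

lemma cellAvg_eq_swap {f : RWSpace d → ℝ} {C : ℝ} (hf : Measurable f)
    (hC : ∀ x, |f x| ≤ C) (α : Fin d → ℤ) :
    cellAvg f α = ∫ y₂, ∫ y₁, f (α, y₁, y₂) ∂unitLeb ∂unitLeb :=
  integral_integral_swap (f := fun y₁ y₂ => f (α, y₁, y₂)) (integrable_cell hf hC α)

/-- On the unit cells, `f` is a function of `α` and `y₁` only. -/
def FactorsFst (f : RWSpace d → ℝ) : Prop :=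
  ∀ x ∈ unitCells d, ∀ x' ∈ unitCells d, x.1 = x'.1 → x.2.1 = x'.2.1 → f x = f x'

/-- On the unit cells, `f` is a function of `α` and `y₂` only. -/
def FactorsSnd (f : RWSpace d → ℝ) : Prop :=
  ∀ x ∈ unitCells d, ∀ x' ∈ unitCells d, x.1 = x'.1 → x.2.2 = x'.2.2 → f x = f x'

lemma integral_mul_eq_cellAvg_mul {f h : RWSpace d → ℝ} {C : ℝ} (hf : Measurable f)
    (hC : ∀ x, |f x| ≤ C) (hff : FactorsFst f) (hhf : FactorsSnd h)
    (hh : Integrable h (rwMeasure d)) :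
    ∫ x, f x * h x ∂rwMeasure d = ∫ x, cellAvg f x.1 * h x ∂rwMeasure d := by
  have h0 : (0 : ℝ) ∈ Set.Ico (0 : ℝ) 1 := by simp
  have hcell : ∀ᵐ y ∂unitLeb.prod unitLeb, y.1 ∈ Set.Ico (0 : ℝ) 1 ∧ y.2 ∈ Set.Ico (0 : ℝ) 1 := by
    rw [Measure.prod_restrict]
    exact ae_restrict_mem (measurableSet_Ico.prod measurableSet_Ico)
  have hmeas : AEStronglyMeasurable (fun x : RWSpace d => cellAvg f x.1) (rwMeasure d) :=
    ((measurable_of_countable (cellAvg f)).comp measurable_fst).aestronglyMeasurable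
  have i₁ : Integrable (fun x => f x * h x) (rwMeasure d) :=
    hh.bdd_mul hf.aestronglyMeasurable (.of_forall hC)
  have i₂ : Integrable (fun x => cellAvg f x.1 * h x) (rwMeasure d) :=
    hh.bdd_mul hmeas (.of_forall fun x => norm_cellAvg_le hC x.1)
  rw [rwMeasure] at i₁ i₂ ⊢
  rw [integral_prod _ i₁, integral_prod _ i₂]
  refine integral_congr_ae (.of_forall fun α => ?_)
  have e₁ : ∀ᵐ y ∂unitLeb.prod unitLeb, f (α, y) = f (α, y.1, 0) := by
    filter_upwards [hcell] with y hy using hff _ hy _ ⟨hy.1, h0⟩ rfl rfl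
  have e₂ : ∀ᵐ y ∂unitLeb.prod unitLeb, h (α, y) = h (α, 0, y.2) := by
    filter_upwards [hcell] with y hy using hhf _ hy _ ⟨h0, hy.2⟩ rfl rfl
  calc ∫ y, f (α, y) * h (α, y) ∂unitLeb.prod unitLeb
      = ∫ y, f (α, y.1, 0) * h (α, 0, y.2) ∂unitLeb.prod unitLeb := by
        refine integral_congr_ae ?_
        filter_upwards [e₁, e₂] with y h₁ h₂ using by rw [h₁, h₂]
    _ = (∫ y, f (α, y, 0) ∂unitLeb) * ∫ y, h (α, 0, y) ∂unitLeb :=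
        integral_prod_mul (fun y => f (α, y, 0)) fun y => h (α, 0, y)
    _ = cellAvg f α * ∫ y, h (α, y) ∂unitLeb.prod unitLeb := by
        rw [cellAvg_eq_integral_prod hf hC, integral_congr_ae e₁, integral_congr_ae e₂,
          integral_fun_fst (fun y => f (α, y, 0)), integral_fun_snd fun y => h (α, 0, y)]
        simp
    _ = ∫ y, cellAvg f α * h (α, y) ∂unitLeb.prod unitLeb := (integral_const_mul _ _).symm

end CellAverages

namespace RW

variable {d : ℕ} (R : RW d)

/-- The map squeezing each unit square onto its `k`-th horizontal strip. -/
def squeeze (k : ℕ) (x : RWSpace d) : RWSpace d := (x.1, x.2.1, R.wt k * x.2.2 + R.q k)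

lemma measurable_squeeze (k : ℕ) : Measurable (R.squeeze k) := by
  unfold squeeze
  fun_prop

variable {f : RWSpace d → ℝ} {C : ℝ}

lemma hasSum_cellAvg (hf : Measurable f) (hC : ∀ x, |f x| ≤ C) (α : Fin d → ℤ) :
    HasSum (fun k => R.wt k * cellAvg (fun x => f (R.squeeze k x)) α) (cellAvg f α) := by
  rw [cellAvg_eq_swap hf hC]
  refine (R.hasSum_integral_idx (h := fun _ y₂ => ∫ y₁, f (α, y₁, y₂) ∂unitLeb)
    (integrable_cell hf hC α).integral_prod_right).congr_fun fun k => ?_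
  exact congrArg (R.wt k * ·) (cellAvg_eq_swap (hf.comp (R.measurable_squeeze k)) (fun x => hC _) α)

lemma hasSum_cellAvg_T (hf : Measurable f) (hC : ∀ x, |f x| ≤ C) (α : Fin d → ℤ) :
    HasSum (fun k => R.wt k * cellAvg (fun x => f (R.squeeze k x)) (α + R.e k))
      (cellAvg (fun x => f (R.T x)) α) := by
  have := R.hasSum_integral_idx (h := fun k y => ∫ y₂, f (α + R.e k, (y - R.q k) / R.p (R.e k),
    R.wt k * y₂ + R.q k) ∂unitLeb)
    (integrable_cell (hf.comp R.measurable_T) (fun x => hC _) α).integral_prod_left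
  refine this.congr_fun fun k => ?_
  rcases (R.wt_nonneg k).eq_or_lt with hk | hk
  · simp [← hk]
  · simp only [add_sub_cancel_right, mul_div_cancel_left₀ _ hk.ne']
    rfl

lemma factorsFst_comp_T (hff : FactorsFst f) : FactorsFst fun x => f (R.T x) := by
  intro x hx x' hx' h₁ h₂
  refine hff _ (R.T_mem hx) _ (R.T_mem hx') ?_ ?_ <;> simp [T, h₁, h₂]

lemma hasSum_cellAvg_T_of_factorsFst (hf : Measurable f) (hC : ∀ x, |f x| ≤ C)
    (hff : FactorsFst f) (α : Fin d → ℤ) :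
    HasSum (fun k => R.wt k * cellAvg f (α + R.e k)) (cellAvg (fun x => f (R.T x)) α) := by
  refine (R.hasSum_cellAvg_T hf hC α).congr_fun fun k => ?_
  rcases (R.wt_nonneg k).eq_or_lt with hk | hk
  · simp [← hk]
  · congr 1
    refine integral_congr_ae ?_
    filter_upwards [ae_unitLeb_mem] with y₁ h₁
    refine integral_congr_ae ?_
    filter_upwards [ae_unitLeb_mem] with y₂ h₂
    exact hff _ ⟨h₁, h₂⟩ _ ⟨h₁, R.Ico_q_subset _ (R.affine_mem_Ico hk h₂)⟩ rfl rfl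

/-- The cell averages of a bounded function, as a bounded function on the lattice. -/
def cellAvgB (f : RWSpace d → ℝ) (hC : ∀ x, |f x| ≤ C) : BddFun (Fin d → ℤ) :=
  BddFun.mk (cellAvg f) C (norm_cellAvg_le hC)

/-- The transition operator of the random walk. -/
def transfer : BddFun (Fin d → ℤ) →L[ℝ] BddFun (Fin d → ℤ) :=
  walkOp (BddFun.shift (Fin d → ℤ)) R.wt R.e

lemma transfer_pow_cellAvgB (hf : Measurable f) (hC : ∀ x, |f x| ≤ C) (hff : FactorsFst f)
    (k : ℕ) (α : Fin d → ℤ) :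
    (R.transfer ^ k) (cellAvgB f hC) α = cellAvg (fun x => f (R.T^[k] x)) α := by
  induction k generalizing f with
  | zero => rfl
  | succ k ih =>
    have h : R.transfer (cellAvgB f hC) = cellAvgB (fun x => f (R.T x)) (fun x => hC _) :=
      BddFun.ext fun β => (BddFun.hasSum_walkOp_apply R.wt_nonneg R.hasSum_wt.summable _ β).unique
        (R.hasSum_cellAvg_T_of_factorsFst hf hC hff β)
    rw [pow_succ, mul_apply_eq_comp, h, ih (f := fun x => f (R.T x)) (hf.comp R.measurable_T) _
      (R.factorsFst_comp_T hff)]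
    simp only [Function.iterate_succ_apply']

lemma closure_sub_eq_top (hspan : AddSubgroup.closure
      {γ : Fin d → ℤ | ∃ β β', 0 < R.p β ∧ 0 < R.p β' ∧ γ = β - β'} = ⊤) :
    AddSubgroup.closure {γ : Fin d → ℤ | ∃ i j, 0 < R.wt i ∧ 0 < R.wt j ∧ γ = R.e i - R.e j} =
      ⊤ := by
  rw [← hspan]
  congr 1
  ext γ
  simp only [Set.mem_ofPred_eq, R.e.surjective.exists]

lemma tendsto_norm_transfer_pow_sub (hspan : AddSubgroup.closure
      {γ : Fin d → ℤ | ∃ β β', 0 < R.p β ∧ 0 < R.p β' ∧ γ = β - β'} = ⊤)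
    (hf : Measurable f) (hC : ∀ x, |f x| ≤ C) (m : ℕ) :
    Tendsto (fun n => ‖(R.transfer ^ n)
      (cellAvgB (fun x => f (R.T^[m] x)) (fun _ => hC _) - cellAvgB f hC)‖) atTop (𝓝 0) := by
  have hC0 : 0 ≤ C := (abs_nonneg _).trans (hC 0)
  induction m generalizing f with
  | zero => simp
  | succ m ih =>
    have h₁ := BddFun.tendsto_norm_walkOp_pow_sub R.wt_nonneg R.hasSum_wt (R.closure_sub_eq_top hspan)
      (L := fun k => cellAvgB (fun x => f (R.squeeze k x)) fun _ => hC _) (C := C)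
      (fun k => (BddFun.norm_le hC0).2 fun α => norm_cellAvg_le (fun _ => hC _) α)
      (Φ₀ := cellAvgB f hC) (Φ₁ := cellAvgB (fun x => f (R.T x)) fun _ => hC _)
      (R.hasSum_cellAvg hf hC) (R.hasSum_cellAvg_T hf hC)
    have h₂ := ih (hf.comp R.measurable_T) fun _ => hC _
    refine squeeze_zero (fun _ => norm_nonneg _) (fun n => ?_) (by simpa only [add_zero] using h₂.add h₁)
    refine le_trans (le_of_eq ?_) (norm_add_le _ _)
    rw [transfer, ← map_add]
    simp only [Function.iterate_succ_apply', Function.comp_def, sub_add_sub_cancel]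

end RW

section BoxAverages

variable {d : ℕ}

/-- The cube of radius `r` around the origin of the lattice. -/
def cube (d r : ℕ) : Finset (Fin d → ℤ) := Finset.Icc (fun _ => -(r : ℤ)) fun _ => (r : ℤ)

lemma rwBox_eq_prod (α : Fin d → ℤ) (r : ℕ) :
    rwBox α r = (((cube d r).map (addLeftEmbedding α) : Finset (Fin d → ℤ)) : Set (Fin d → ℤ)) ×ˢ
      (Set.Ico (0 : ℝ) 1 ×ˢ Set.Ico (0 : ℝ) 1) := by
  have h (γ : Fin d → ℤ) : (∀ i, |γ i - α i| ≤ (r : ℤ)) ↔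
      γ ∈ (cube d r).map (addLeftEmbedding α) := by
    simp only [Finset.mem_map, addLeftEmbedding_apply, cube, Finset.mem_Icc, Pi.le_def, abs_le]
    constructor
    · exact fun h => ⟨γ - α, ⟨fun i => (h i).1, fun i => (h i).2⟩, add_sub_cancel _ _⟩
    · rintro ⟨δ, hδ, rfl⟩ i
      simpa using ⟨hδ.1 i, hδ.2 i⟩
  ext x
  exact and_congr_left' (h x.1)

lemma rwMeasure_rwBox (α : Fin d → ℤ) (r : ℕ) :
    (rwMeasure d (rwBox α r)).toReal = (cube d r).card := by
  rw [rwBox_eq_prod, rwMeasure, Measure.prod_prod, Measure.prod_prod, Measure.count_apply_finset]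
  simp

lemma setIntegral_rwBox {f : RWSpace d → ℝ} {C : ℝ} (hf : Measurable f) (hC : ∀ x, |f x| ≤ C)
    (α : Fin d → ℤ) (r : ℕ) :
    ∫ x in rwBox α r, f x ∂rwMeasure d = ∑ γ ∈ cube d r, cellAvg f (α + γ) := by
  have hfin : rwMeasure d (rwBox α r) ≠ ⊤ := by
    rw [rwBox_eq_prod, rwMeasure, Measure.prod_prod, Measure.prod_prod, Measure.count_apply_finset]
    simp
  have hint : IntegrableOn f (rwBox α r) (rwMeasure d) :=
    Measure.integrableOn_of_bounded hfin hf.aestronglyMeasurable (.of_forall hC)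
  rw [rwBox_eq_prod, rwMeasure] at hint ⊢
  have hint' := hint
  rw [IntegrableOn, ← Measure.prod_restrict] at hint'
  rw [setIntegral_prod _ hint, setIntegral_finset _ hint'.integral_prod_left, Finset.sum_map]
  refine Finset.sum_congr rfl fun γ _ => ?_
  rw [cellAvg_eq_integral_prod hf hC, Measure.prod_restrict, Measure.restrict_restrict
    (measurableSet_Ico.prod measurableSet_Ico), Set.inter_self]
  simp

lemma le_card_cube (hd : 1 ≤ d) (r : ℕ) : r ≤ (cube d r).card := by
  have h : (cube d r).card = (2 * r + 1) ^ d := by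
    rw [cube, Pi.card_Icc]
    simp only [Int.card_Icc, Finset.prod_const, Finset.card_univ, Fintype.card_fin]
    congr 1
    omega
  rw [h]
  exact le_trans (by omega) (Nat.le_self_pow (by omega) _)

lemma HasAvg.exists_cube {f : RWSpace d → ℝ} {C A : ℝ} (hd : 1 ≤ d)
    (h : HasAvg (rwMeasure d) (rwFamily d) f A) (hf : Measurable f) (hC : ∀ x, |f x| ≤ C)
    {ε : ℝ} (hε : 0 < ε) :
    ∃ r, ∀ α, |(∑ γ ∈ cube d r, cellAvg f (α + γ)) / (cube d r).card - A| ≤ ε := by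
  obtain ⟨M, -, hM⟩ := h ε hε
  obtain ⟨r, hr⟩ := exists_nat_ge (max M 1)
  refine ⟨r, fun α => ?_⟩
  have hr1 : 1 ≤ r := by exact_mod_cast (le_max_right M 1).trans hr
  have := hM (rwBox α r) ⟨α, r, hr1, rfl⟩ (by
    rw [rwMeasure_rwBox]
    exact ((le_max_left M 1).trans hr).trans (by exact_mod_cast le_card_cube hd r))
  rw [avgOn, setIntegral_rwBox hf hC, rwMeasure_rwBox] at this
  exact this.le

end BoxAverages

section Measurability

variable {d : ℕ} (R : RW d)

lemma rwB0_le : rwB0 d ≤ inferInstanceAs (MeasurableSpace (RWSpace d)) := by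
  refine MeasurableSpace.generateFrom_le ?_
  rintro _ ⟨α, rfl⟩
  exact (measurableSet_singleton α).prod (measurableSet_Ico.prod measurableSet_Ico)

lemma RW.measurable_iterZ (k : ℤ) : Measurable (R.iterZ k) := by
  unfold iterZ
  split
  · exact R.measurable_T.iterate _
  · exact R.measurable_Tinv.iterate _

lemma rwBlm_le (l m : ℤ) : rwBlm R l m ≤ inferInstanceAs (MeasurableSpace (RWSpace d)) :=
  iSup₂_le fun k _ => (MeasurableSpace.comap_mono rwB0_le).trans (R.measurable_iterZ k).comap_le

/-- The σ-algebra of sets that do not separate two given points. -/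
abbrev nonSeparating {X : Type*} (x x' : X) : MeasurableSpace X where
  MeasurableSet' S := x ∈ S ↔ x' ∈ S
  measurableSet_empty := Iff.rfl
  measurableSet_compl _ h := not_congr h
  measurableSet_iUnion f h := by simp only [Set.mem_iUnion, h]

lemma eq_of_measurable_nonSeparating {X : Type*} {x x' : X} {f : X → ℝ}
    (hf : Measurable[nonSeparating x x'] f) : f x = f x' :=
  ((hf (measurableSet_singleton (f x))).1 rfl).symm

lemma rwB0_le_nonSeparating {x x' : RWSpace d} (hx : x ∈ unitCells d) (hx' : x' ∈ unitCells d)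
    (h : x.1 = x'.1) : rwB0 d ≤ nonSeparating x x' := by
  refine MeasurableSpace.generateFrom_le ?_
  rintro _ ⟨α, rfl⟩
  exact and_congr (by rw [h]) (iff_of_true hx hx')

lemma RW.eq_of_measurable_rwBlm {l m : ℤ} {f : RWSpace d → ℝ} (hf : Measurable[rwBlm R l m] f)
    {x x' : RWSpace d} (h : ∀ k, l ≤ k → k ≤ m → R.iterZ k x ∈ unitCells d ∧
      R.iterZ k x' ∈ unitCells d ∧ (R.iterZ k x).1 = (R.iterZ k x').1) : f x = f x' := by
  refine eq_of_measurable_nonSeparating (hf.mono (iSup₂_le fun k hk => ?_) le_rfl)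
  obtain ⟨hkl, hkm⟩ := Finset.mem_Icc.1 hk
  obtain ⟨h₁, h₂, h₃⟩ := h k hkl hkm
  rintro _ ⟨S, hS, rfl⟩
  exact rwB0_le_nonSeparating h₁ h₂ h₃ _ hS

namespace RW

lemma iterZ_T_iterate {m : ℕ} {k : ℤ} (hk : -(m : ℤ) ≤ k) {x : RWSpace d} (hx : x ∈ unitCells d) :
    R.iterZ k (R.T^[m] x) = R.T^[(k + m).toNat] x := by
  unfold iterZ
  split_ifs with h
  · rw [← Function.iterate_add_apply]
    congr 2
    omega
  · obtain ⟨j, rfl⟩ : ∃ j : ℕ, m = (-k).toNat + j := ⟨m - (-k).toNat, by omega⟩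
    rw [Function.iterate_add_apply, R.Tinv_iterate_T_iterate _ (R.T_iterate_mem _ hx)]
    congr 2
    omega

lemma iterZ_Tinv_iterate {m : ℕ} {k : ℤ} (hk : k ≤ m) {x : RWSpace d} (hx : x ∈ unitCells d) :
    R.iterZ k (R.Tinv^[m] x) = R.Tinv^[(m - k).toNat] x := by
  unfold iterZ
  split_ifs with h
  · obtain ⟨j, rfl⟩ : ∃ j : ℕ, m = k.toNat + j := ⟨m - k.toNat, by omega⟩
    rw [Function.iterate_add_apply, R.T_iterate_Tinv_iterate _ (R.Tinv_iterate_mem _ hx)]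
    congr 2
    omega
  · rw [← Function.iterate_add_apply]
    congr 2
    omega

lemma T_iterate_congr (n : ℕ) {x x' : RWSpace d} (h₁ : x.1 = x'.1) (h₂ : x.2.1 = x'.2.1) :
    (R.T^[n] x).1 = (R.T^[n] x').1 := by
  induction n generalizing x x' with
  | zero => exact h₁
  | succ n ih => exact ih (by simp [T, h₁, h₂]) (by simp [T, h₂])

lemma Tinv_iterate_congr (n : ℕ) {x x' : RWSpace d} (h₁ : x.1 = x'.1) (h₂ : x.2.2 = x'.2.2) :
    (R.Tinv^[n] x).1 = (R.Tinv^[n] x').1 := by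
  induction n generalizing x x' with
  | zero => exact h₁
  | succ n ih => exact ih (by simp [Tinv, h₁, h₂]) (by simp [Tinv, h₂])

lemma factorsFst_of_measurable {m : ℕ} {l : ℤ} {f : RWSpace d → ℝ}
    (hf : Measurable[rwBlm R (-(m : ℤ)) l] f) : FactorsFst fun x => f (R.T^[m] x) := by
  intro x hx x' hx' h₁ h₂
  refine R.eq_of_measurable_rwBlm hf fun k hk _ => ?_
  rw [R.iterZ_T_iterate hk hx, R.iterZ_T_iterate hk hx']
  exact ⟨R.T_iterate_mem _ hx, R.T_iterate_mem _ hx', R.T_iterate_congr _ h₁ h₂⟩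

lemma factorsSnd_of_measurable {m : ℕ} {l : ℤ} {f : RWSpace d → ℝ}
    (hf : Measurable[rwBlm R l (m : ℤ)] f) : FactorsSnd fun x => f (R.Tinv^[m] x) := by
  intro x hx x' hx' h₁ h₂
  refine R.eq_of_measurable_rwBlm hf fun k _ hk => ?_
  rw [R.iterZ_Tinv_iterate hk hx, R.iterZ_Tinv_iterate hk hx']
  exact ⟨R.Tinv_iterate_mem _ hx, R.Tinv_iterate_mem _ hx', R.Tinv_iterate_congr _ h₁ h₂⟩

lemma factorsFst_T_iterate {f : RWSpace d → ℝ} (hf : FactorsFst f) (n : ℕ) :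
    FactorsFst fun x => f (R.T^[n] x) := by
  induction n with
  | zero => exact hf
  | succ n ih => exact R.factorsFst_comp_T ih

end RW

end Measurability

namespace RW

variable {d : ℕ} (R : RW d)

lemma integral_comp_iterate_mul {m : ℕ} {F g : RWSpace d → ℝ} {C : ℝ}
    (hF : Measurable[rwBlm R (-(m : ℤ)) (m : ℤ)] F) (hC : ∀ x, |F x| ≤ C)
    (hg : Measurable[rwBlm R (-(m : ℤ)) (m : ℤ)] g) (hgi : Integrable g (rwMeasure d)) (n : ℕ) :
    ∫ x, F (R.T^[n + 2 * m] x) * g x ∂rwMeasure d =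
      ∫ x, (R.transfer ^ n) (cellAvgB (fun x => F (R.T^[m] x)) fun _ => hC _) x.1 *
        g (R.Tinv^[m] x) ∂rwMeasure d := by
  have hF' : Measurable F := hF.mono (rwBlm_le R _ _) le_rfl
  have hg' : Measurable g := hg.mono (rwBlm_le R _ _) le_rfl
  have hff := R.factorsFst_of_measurable hF
  have hFm : Measurable fun x => F (R.T^[m] x) := hF'.comp (R.measurable_T.iterate m)
  rw [← R.integral_Tinv_iterate m (f := fun x => F (R.T^[n + 2 * m] x) * g x)
    ((hF'.comp (R.measurable_T.iterate _)).mul hg')]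
  calc _ = ∫ x, F (R.T^[m] (R.T^[n] x)) * g (R.Tinv^[m] x) ∂rwMeasure d := by
        refine integral_congr_ae ?_
        filter_upwards [ae_mem_unitCells d] with x hx
        rw [show n + 2 * m = m + n + m by ring, Function.iterate_add_apply,
          R.T_iterate_Tinv_iterate m hx, Function.iterate_add_apply]
    _ = ∫ x, cellAvg (fun x => F (R.T^[m] (R.T^[n] x))) x.1 * g (R.Tinv^[m] x) ∂rwMeasure d :=
        integral_mul_eq_cellAvg_mul (hFm.comp (R.measurable_T.iterate n)) (fun _ => hC _)
          (R.factorsFst_T_iterate hff n) (R.factorsSnd_of_measurable hg)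
          ((R.measurePreserving_Tinv.iterate m).integrable_comp_of_integrable hgi)
    _ = _ := by simp only [R.transfer_pow_cellAvgB hFm _ hff]

lemma eventually_abs_transfer_pow_sub_le (hd : 1 ≤ d) (hspan : AddSubgroup.closure
      {γ : Fin d → ℤ | ∃ β β', 0 < R.p β ∧ 0 < R.p β' ∧ γ = β - β'} = ⊤)
    {F : RWSpace d → ℝ} {C A : ℝ} (hF : Measurable F) (hC : ∀ x, |F x| ≤ C)
    (hAvg : HasAvg (rwMeasure d) (rwFamily d) F A) (m : ℕ) {ε : ℝ} (hε : 0 < ε) :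
    ∀ᶠ n in atTop, ∀ α,
      |(R.transfer ^ n) (cellAvgB (fun x => F (R.T^[m] x)) fun _ => hC _) α - A| ≤ ε := by
  obtain ⟨r, hr⟩ := hAvg.exists_cube hd hF hC (ε := ε / 4) (by positivity)
  have hne : (cube d r).Nonempty := Finset.nonempty_Icc.2 fun _ => by simp
  filter_upwards [BddFun.eventually_abs_walkOp_pow_sub_le (Φ := cellAvgB F hC) R.wt_nonneg
    R.hasSum_wt (R.closure_sub_eq_top hspan) (by positivity) hne hr,
    (R.tendsto_norm_transfer_pow_sub hspan hF hC m).eventually_le_const (half_pos hε)]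
    with n h₁ h₂ α
  have h₃ := (BddFun.norm_apply_le _ α).trans h₂
  rw [map_sub] at h₃
  have h₄ : |(R.transfer ^ n) (cellAvgB (fun x => F (R.T^[m] x)) fun _ => hC _) α -
    (R.transfer ^ n) (cellAvgB F hC) α| ≤ ε / 2 := h₃
  have h₅ : |(R.transfer ^ n) (cellAvgB F hC) α - A| ≤ 2 * (ε / 4) := h₁ α
  calc _ ≤ _ := abs_sub_le _ ((R.transfer ^ n) (cellAvgB F hC) α) A
    _ ≤ ε := by linarith

end RW

/-- Theorem 4.8(a): under the moment condition (i) and the aperiodicity condition (ii),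
the random-walk system is (M5)-mixing relative to `𝔊_m` and `𝔏_m := L¹(X, ℬ_{−m,m}, μ)`,
for every `m ∈ ℕ`. -/
theorem rw_M5 (d : ℕ) (hd : 1 ≤ d) (R : RW d)
    (hcard : ∃ β β' : Fin d → ℤ, 0 < R.p β ∧ 0 < R.p β' ∧ β ≠ β')
    (hmom : Summable fun β : Fin d → ℤ =>
      Real.sqrt (∑ i, ((β i : ℝ)) ^ 2) ^ (max 2 (d / 2 + 1)) * R.p β)
    (hspan : AddSubgroup.closure
      {γ : Fin d → ℤ | ∃ β β', 0 < R.p β ∧ 0 < R.p β' ∧ γ = β - β'} = ⊤)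
    (m : ℕ) (F : RWSpace d → ℝ)
    (hFmeas : Measurable[rwBlm R (-(m : ℤ)) (m : ℤ)] F)
    (hFbdd : ∃ C, ∀ x, |F x| ≤ C)
    (A : ℝ) (hAvg : HasAvg (rwMeasure d) (rwFamily d) F A) :
    ∀ ε > 0, ∃ N : ℕ, ∀ n ≥ N, ∀ g : RWSpace d → ℝ,
      Measurable[rwBlm R (-(m : ℤ)) (m : ℤ)] g → Integrable g (rwMeasure d) →
      (∫ x, |g x| ∂(rwMeasure d)) ≠ 0 →
      |(∫ x, F ((R.T)^[n] x) * g x ∂(rwMeasure d)) - A * ∫ x, g x ∂(rwMeasure d)|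
        < ε * ∫ x, |g x| ∂(rwMeasure d) := by
  intro ε hε
  obtain ⟨C, hC⟩ := hFbdd
  have hF : Measurable F := hFmeas.mono (rwBlm_le R _ _) le_rfl
  obtain ⟨N, hN⟩ := eventually_atTop.1
    (R.eventually_abs_transfer_pow_sub_le hd hspan hF hC hAvg m (half_pos hε))
  refine ⟨N + 2 * m, fun n hn g hg hgi hg0 => ?_⟩
  obtain ⟨k, rfl⟩ : ∃ k, n = k + 2 * m := ⟨n - 2 * m, by omega⟩
  have hk := hN k (by omega)
  have hg' : Measurable g := hg.mono (rwBlm_le R _ _) le_rfl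
  set Ψ := (R.transfer ^ k) (RW.cellAvgB (fun x => F (R.T^[m] x)) fun _ => hC _) with hΨ
  set h : RWSpace d → ℝ := fun x => g (R.Tinv^[m] x) with hh
  have hhi : Integrable h (rwMeasure d) :=
    (R.measurePreserving_Tinv.iterate m).integrable_comp_of_integrable hgi
  have hΨm : AEStronglyMeasurable (fun x : RWSpace d => Ψ x.1) (rwMeasure d) :=
    ((measurable_of_countable fun α => Ψ α).comp measurable_fst).aestronglyMeasurable
  have hpos : 0 < ∫ x, |g x| ∂rwMeasure d :=
    (integral_nonneg fun _ => abs_nonneg _).lt_of_ne' hg0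
  rw [R.integral_comp_iterate_mul hFmeas hC hg hgi, ← R.integral_Tinv_iterate m hg',
    ← integral_const_mul, ← integral_sub
      (hhi.bdd_mul hΨm (.of_forall fun x => BddFun.norm_apply_le Ψ x.1)) (hhi.const_mul A)]
  calc _ ≤ ∫ x, ε / 2 * |h x| ∂rwMeasure d := by
        rw [← Real.norm_eq_abs]
        refine norm_integral_le_of_norm_le (hhi.abs.const_mul _) (.of_forall fun x => ?_)
        rw [← sub_mul, norm_mul]
        exact mul_le_mul_of_nonneg_right (hk x.1) (abs_nonneg _)
    _ = ε / 2 * ∫ x, |g x| ∂rwMeasure d := by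
        rw [integral_const_mul, ← R.integral_Tinv_iterate m hg'.abs]
    _ < ε * ∫ x, |g x| ∂rwMeasure d := by
        exact mul_lt_mul_of_pos_right (half_lt_self hε) hpos
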